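/- In the doubled quartet construction (T^0_j = T_j for the quartets T_1 = ab|cd and T_2 = ac|bd, and T^{i+1}_j = (T^i_j, T^i_j) for j ∈ {1,2}), for every i ≥ 0: d_MAF(T^{i+1}_1, T^{i+1}_2) ≥ 2·d_MAF(T^i_1, T^i_2) − 1 > d_MAF(T^i_1, T^i_2). -/

import Mathlib

open SimpleGraph

/-- `G` has a tree decomposition of width at most `k`: a tree `t` together with
bags satisfying (tw1), (tw2) and (tw3), all of whose bags have size at most `k+1`. -/
def HasTreeDecompWidthLE {V : Type*} (G : SimpleGraph V) (k : ℕ) : Prop :=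
  ∃ (n : ℕ) (t : SimpleGraph (Fin (n + 1))) (bag : Fin (n + 1) → Finset V),
    t.IsTree ∧
    (∀ v : V, ∃ i, v ∈ bag i) ∧
    (∀ u v : V, G.Adj u v → ∃ i, u ∈ bag i ∧ v ∈ bag i) ∧
    (∀ v : V, (t.induce {i | v ∈ bag i}).Connected) ∧
    (∀ i, (bag i).card ≤ k + 1)

/-- The treewidth of a graph: the least `k` such that `G` has a tree decomposition
of width `k`. -/
noncomputable def treewidth {V : Type*} (G : SimpleGraph V) : ℕ :=
  sInf {k | HasTreeDecompWidthLE G k}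

/-- An unrooted binary phylogenetic tree together with a single distinguished
degree-2 internal vertex (its `hub`); all other internal vertices have
degree 3. -/
structure QTree (V : Type*) (X : Type*) where
  graph : SimpleGraph V
  finite : Finite V
  connected : graph.Connected
  acyclic : graph.IsAcyclic
  leaf : X → V
  leaf_inj : Function.Injective leaf
  leaf_deg : ∀ x : X, (graph.neighborSet (leaf x)).ncard = 1
  hub : V
  hub_not_leaf : ∀ x : X, leaf x ≠ hub
  hub_deg : (graph.neighborSet hub).ncard = 2
  internal_deg : ∀ v : V, (∀ x : X, leaf x ≠ v) → v ≠ hub → (graph.neighborSet v).ncard = 3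

/-- `T` is the quartet `ab|cd`, with the hub subdividing its middle edge:
`a, b` are attached to a common vertex, `c, d` are attached to a common vertex,
and these two vertices are the neighbours of the hub. -/
def IsQuartet {V X : Type*} (T : QTree V X) (a b c d : X) : Prop :=
  ∃ u w : V, T.graph.Adj u (T.leaf a) ∧ T.graph.Adj u (T.leaf b) ∧
    T.graph.Adj w (T.leaf c) ∧ T.graph.Adj w (T.leaf d) ∧
    T.graph.Adj T.hub u ∧ T.graph.Adj T.hub w

/-- `T'` is the doubling `(T, T)` of `T`: two copies of `T` whose hubs are
joined by an edge, subdivided by the new hub of `T'`; the taxa of the first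
(resp. second) copy are labelled by the left (resp. right) summand. -/
def IsDoubling {V V' X : Type*} (T : QTree V X) (T' : QTree V' (X ⊕ X)) : Prop :=
  ∃ φ1 φ2 : V → V',
    Function.Injective φ1 ∧ Function.Injective φ2 ∧
    (∀ v w : V, φ1 v ≠ φ2 w) ∧
    (∀ v : V, φ1 v ≠ T'.hub) ∧ (∀ v : V, φ2 v ≠ T'.hub) ∧
    (∀ w' : V', w' = T'.hub ∨ (∃ v, φ1 v = w') ∨ (∃ v, φ2 v = w')) ∧
    (∀ x : X, φ1 (T.leaf x) = T'.leaf (Sum.inl x)) ∧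
    (∀ x : X, φ2 (T.leaf x) = T'.leaf (Sum.inr x)) ∧
    (∀ u v : V, T.graph.Adj u v ↔ T'.graph.Adj (φ1 u) (φ1 v)) ∧
    (∀ u v : V, T.graph.Adj u v ↔ T'.graph.Adj (φ2 u) (φ2 v)) ∧
    (∀ u v : V, ¬ T'.graph.Adj (φ1 u) (φ2 v)) ∧
    T'.graph.Adj T'.hub (φ1 T.hub) ∧ T'.graph.Adj T'.hub (φ2 T.hub) ∧
    (∀ w' : V', T'.graph.Adj T'.hub w' → w' = φ1 T.hub ∨ w' = φ2 T.hub)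

/-- The label sets of the iterated doubling construction:
`lab 0 = Fin 4` and `lab (i+1) = lab i ⊕ lab i`. -/
def lab : ℕ → Type
  | 0 => Fin 4
  | i + 1 => lab i ⊕ lab i

/-- The support of the path between `a` and `b` in `G` (in a tree there is at
most one such path). -/
def pathSupport {V : Type*} (G : SimpleGraph V) (a b : V) : Set V :=
  {v | ∃ w : G.Walk a b, w.IsPath ∧ v ∈ w.support}

/-- The leaf-labelled graph `(G, l)` displays the quartet `ab|cd`: the path from
`a` to `b` and the path from `c` to `d` are vertex-disjoint. -/
def QuartetSplit {V X : Type*} (G : SimpleGraph V) (l : X → V) (a b c d : X) : Prop :=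
  pathSupport G (l a) (l b) ∩ pathSupport G (l c) (l d) = ∅

/-- The vertex set `T(Y)` of the minimal subtree of `(G, l)` connecting the
leaves labelled by `Y`. -/
def leafSpan {V X : Type*} (G : SimpleGraph V) (l : X → V) (Y : Set X) : Set V :=
  {v | ∃ x ∈ Y, ∃ y ∈ Y, v ∈ pathSupport G (l x) (l y)}

/-- `T1|Y = T2|Y`: the restrictions of the two leaf-labelled trees to the label
set `Y` are equal (a binary tree being determined by its displayed quartets,
this says that within `Y` the two trees display the same quartets). -/
def SameRestriction {V1 V2 X : Type*} (G1 : SimpleGraph V1) (l1 : X → V1)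
    (G2 : SimpleGraph V2) (l2 : X → V2) (Y : Set X) : Prop :=
  ∀ a ∈ Y, ∀ b ∈ Y, ∀ c ∈ Y, ∀ d ∈ Y,
    a ≠ b → a ≠ c → a ≠ d → b ≠ c → b ≠ d → c ≠ d →
    (QuartetSplit G1 l1 a b c d ↔ QuartetSplit G2 l2 a b c d)

/-- `blocks` is an agreement forest of the two leaf-labelled trees with `k`
components: a partition of the label set into `k` nonempty blocks whose minimal
spanning subtrees are pairwise vertex-disjoint in each tree, and on each block
the two trees have equal restrictions. -/
def IsAgreementForest {V1 V2 X : Type*} (G1 : SimpleGraph V1) (l1 : X → V1)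
    (G2 : SimpleGraph V2) (l2 : X → V2) (k : ℕ) (blocks : Fin k → Set X) : Prop :=
  (∀ i, (blocks i).Nonempty) ∧
  (∀ x : X, ∃! i, x ∈ blocks i) ∧
  (∀ i j, i ≠ j → leafSpan G1 l1 (blocks i) ∩ leafSpan G1 l1 (blocks j) = ∅) ∧
  (∀ i j, i ≠ j → leafSpan G2 l2 (blocks i) ∩ leafSpan G2 l2 (blocks j) = ∅) ∧
  (∀ i, SameRestriction G1 l1 G2 l2 (blocks i))

/-- `d_MAF`: the minimum number of components of an agreement forest of the two
leaf-labelled trees. -/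
noncomputable def dMAF {V1 V2 X : Type*} (G1 : SimpleGraph V1) (l1 : X → V1)
    (G2 : SimpleGraph V2) (l2 : X → V2) : ℕ :=
  sInf {k | ∃ blocks : Fin k → Set X, IsAgreementForest G1 l1 G2 l2 k blocks}

lemma pathSupport_eq_of_isPath {V : Type*} {G : SimpleGraph V} (hG : G.IsAcyclic) {a b : V}
    (p : G.Walk a b) (hp : p.IsPath) : pathSupport G a b = {v | v ∈ p.support} := by
  ext v
  constructor
  · rintro ⟨w, hw, hv⟩
    have h : (⟨w, hw⟩ : G.Path a b) = ⟨p, hp⟩ := hG.path_unique _ _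
    have h' : w = p := congrArg Subtype.val h
    subst h'
    exact hv
  · intro hv
    exact ⟨p, hp, hv⟩

lemma pathSupport_image {V V' : Type*} {G : SimpleGraph V} {G' : SimpleGraph V'}
    (hG : G.IsAcyclic) (hc : G.Connected) (hG' : G'.IsAcyclic) (φ : V → V')
    (hφ : Function.Injective φ) (hadj : ∀ u v, G.Adj u v ↔ G'.Adj (φ u) (φ v)) (a b : V) :
    pathSupport G' (φ a) (φ b) = φ '' pathSupport G a b := by
  classical
  obtain ⟨p, hp⟩ := (hc.preconnected a b).exists_isPath
  let f : G →g G' := ⟨φ, fun {u v} h => (hadj u v).1 h⟩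
  have hq : (p.map f).IsPath := Walk.map_isPath_of_injective hφ hp
  rw [pathSupport_eq_of_isPath hG p hp]
  have h2 := pathSupport_eq_of_isPath hG' (p.map f) hq
  change pathSupport G' (φ a) (φ b) = _ at h2
  rw [h2]
  ext v
  simp [f]

lemma dMAF_le_of_fintype {V1 V2 X ι : Type*} [Fintype ι] (G1 : SimpleGraph V1) (l1 : X → V1)
    (G2 : SimpleGraph V2) (l2 : X → V2) (B : ι → Set X)
    (hne : ∀ i, (B i).Nonempty) (hex : ∀ x : X, ∃! i, x ∈ B i)
    (h1 : ∀ i j, i ≠ j → leafSpan G1 l1 (B i) ∩ leafSpan G1 l1 (B j) = ∅)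
    (h2 : ∀ i j, i ≠ j → leafSpan G2 l2 (B i) ∩ leafSpan G2 l2 (B j) = ∅)
    (hs : ∀ i, SameRestriction G1 l1 G2 l2 (B i)) :
    ∃ blocks : Fin (Fintype.card ι) → Set X,
      IsAgreementForest G1 l1 G2 l2 (Fintype.card ι) blocks := by
  let e := (Fintype.equivFin ι).symm
  refine ⟨fun k => B (e k), fun k => hne _, ?_, ?_, ?_, fun k => hs _⟩
  · intro x
    obtain ⟨i, hi, hu⟩ := hex x
    refine ⟨e.symm i, by simpa using hi, ?_⟩
    intro k hk
    rw [← hu _ hk]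
    simp
  · intro i j hij
    exact h1 _ _ (fun h => hij (e.injective h))
  · intro i j hij
    exact h2 _ _ (fun h => hij (e.injective h))

lemma pathSupport_self {V : Type*} (G : SimpleGraph V) (a v : V) (h : v ∈ pathSupport G a a) :
    v = a := by
  obtain ⟨w, hw, hv⟩ := h
  have := Walk.isPath_iff_eq_nil.1 hw
  subst this
  simpa using hv

lemma exists_forest {V1 V2 X : Type*} [Finite X] (T1 : QTree V1 X) (T2 : QTree V2 X) :
    ∃ k, ∃ blocks : Fin k → Set X,
      IsAgreementForest T1.graph T1.leaf T2.graph T2.leaf k blocks := by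
  have := Fintype.ofFinite X
  have key : ∀ {V : Type _} (T : QTree V X) (i j : X), i ≠ j →
      leafSpan T.graph T.leaf {i} ∩ leafSpan T.graph T.leaf {j} = ∅ := by
    intro V T i j hij
    rw [Set.eq_empty_iff_forall_notMem]
    rintro v ⟨⟨x, hx, y, hy, h⟩, ⟨x', hx', y', hy', h'⟩⟩
    rw [Set.mem_singleton_iff] at hx hy hx' hy'
    subst hx hx'
    rw [hy] at h
    rw [hy'] at h'
    exact hij (T.leaf_inj ((pathSupport_self _ _ _ h).symm.trans (pathSupport_self _ _ _ h')))
  refine ⟨_, dMAF_le_of_fintype _ _ _ _ (fun x : X => ({x} : Set X)) (fun x => ⟨x, rfl⟩)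
    ?_ ?_ ?_ ?_⟩
  · intro x
    exact ⟨x, rfl, fun y hy => (Set.mem_singleton_iff.1 hy).symm⟩
  · intro i j hij
    rw [Set.eq_empty_iff_forall_notMem]
    rintro v ⟨⟨x, hx, y, hy, h⟩, ⟨x', hx', y', hy', h'⟩⟩
    rw [Set.mem_singleton_iff] at hx hy hx' hy'
    subst hx hx'
    rw [hy] at h
    rw [hy'] at h'
    exact hij (T1.leaf_inj ((pathSupport_self _ _ _ h).symm.trans (pathSupport_self _ _ _ h')))
  · intro i j hij
    exact key T2 i j hij
  · intro i a ha b hb c hc d hd hab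
    exact absurd (ha.trans hb.symm) hab

lemma leafSpan_image {V V' X X' : Type*} {G : SimpleGraph V} {G' : SimpleGraph V'}
    (hG : G.IsAcyclic) (hc : G.Connected) (hG' : G'.IsAcyclic) (φ : V → V')
    (hφ : Function.Injective φ) (hadj : ∀ u v, G.Adj u v ↔ G'.Adj (φ u) (φ v))
    (l : X → V) (l' : X' → V') (s : X → X') (hl : ∀ x, φ (l x) = l' (s x)) (B : Set X')
    (v : V) (hv : v ∈ leafSpan G l (s ⁻¹' B)) : φ v ∈ leafSpan G' l' B := by
  obtain ⟨x, hx, y, hy, h⟩ := hv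
  refine ⟨s x, hx, s y, hy, ?_⟩
  rw [← hl, ← hl, pathSupport_image hG hc hG' φ hφ hadj]
  exact ⟨v, h, rfl⟩

lemma quartetSplit_image {V V' X X' : Type*} {G : SimpleGraph V} {G' : SimpleGraph V'}
    (hG : G.IsAcyclic) (hc : G.Connected) (hG' : G'.IsAcyclic) (φ : V → V')
    (hφ : Function.Injective φ) (hadj : ∀ u v, G.Adj u v ↔ G'.Adj (φ u) (φ v))
    (l : X → V) (l' : X' → V') (s : X → X') (hl : ∀ x, φ (l x) = l' (s x)) (a b c d : X) :
    QuartetSplit G' l' (s a) (s b) (s c) (s d) ↔ QuartetSplit G l a b c d := by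
  unfold QuartetSplit
  rw [← hl, ← hl, ← hl, ← hl, pathSupport_image hG hc hG' φ hφ hadj,
    pathSupport_image hG hc hG' φ hφ hadj, ← Set.image_inter hφ, Set.image_eq_empty]

/-- Restricting an agreement forest to an embedded pair of subtrees. -/
lemma restrict_forest {V1 V2 V1' V2' X X' : Type*}
    (T1 : QTree V1 X) (T2 : QTree V2 X) (T1' : QTree V1' X') (T2' : QTree V2' X')
    (s : X → X') (hsi : Function.Injective s)
    (φ : V1 → V1') (hφ : Function.Injective φ)
    (hφa : ∀ u v, T1.graph.Adj u v ↔ T1'.graph.Adj (φ u) (φ v))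
    (hφl : ∀ x, φ (T1.leaf x) = T1'.leaf (s x))
    (ψ : V2 → V2') (hψ : Function.Injective ψ)
    (hψa : ∀ u v, T2.graph.Adj u v ↔ T2'.graph.Adj (ψ u) (ψ v))
    (hψl : ∀ x, ψ (T2.leaf x) = T2'.leaf (s x))
    (k : ℕ) (B : Fin k → Set X')
    (hB : IsAgreementForest T1'.graph T1'.leaf T2'.graph T2'.leaf k B)
    (S : Finset (Fin k)) (hS : ∀ j, j ∈ S ↔ ∃ x, s x ∈ B j) :
    dMAF T1.graph T1.leaf T2.graph T2.leaf ≤ S.card := by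
  obtain ⟨hne, hex, hd1, hd2, hr⟩ := hB
  rw [← Fintype.card_coe S]
  apply Nat.sInf_le
  apply dMAF_le_of_fintype _ _ _ _ (fun j : S => s ⁻¹' (B j))
  · rintro ⟨j, hj⟩
    exact (hS j).1 hj
  · intro x
    obtain ⟨j, hj, hu⟩ := hex (s x)
    exact ⟨⟨j, (hS j).2 ⟨x, hj⟩⟩, hj, fun y hy => Subtype.ext (hu y hy)⟩
  · intro i j hij
    rw [Set.eq_empty_iff_forall_notMem]
    rintro v ⟨h, h'⟩
    have := hd1 i j (fun h => hij (Subtype.ext h))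
    rw [Set.eq_empty_iff_forall_notMem] at this
    exact this (φ v)
      ⟨leafSpan_image T1.acyclic T1.connected T1'.acyclic φ hφ hφa _ _ s hφl _ v h,
       leafSpan_image T1.acyclic T1.connected T1'.acyclic φ hφ hφa _ _ s hφl _ v h'⟩
  · intro i j hij
    rw [Set.eq_empty_iff_forall_notMem]
    rintro v ⟨h, h'⟩
    have := hd2 i j (fun h => hij (Subtype.ext h))
    rw [Set.eq_empty_iff_forall_notMem] at this
    exact this (ψ v)
      ⟨leafSpan_image T2.acyclic T2.connected T2'.acyclic ψ hψ hψa _ _ s hψl _ v h,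
       leafSpan_image T2.acyclic T2.connected T2'.acyclic ψ hψ hψa _ _ s hψl _ v h'⟩
  · intro j a ha b hb c hc d hd hab hac had hbc hbd hcd
    rw [← quartetSplit_image T1.acyclic T1.connected T1'.acyclic φ hφ hφa _ _ s hφl,
      ← quartetSplit_image T2.acyclic T2.connected T2'.acyclic ψ hψ hψa _ _ s hψl]
    exact hr j _ ha _ hb _ hc _ hd (hsi.ne hab) (hsi.ne hac) (hsi.ne had) (hsi.ne hbc)
      (hsi.ne hbd) (hsi.ne hcd)

lemma hub_mem_walk {V V' : Type*} {G' : SimpleGraph V'} {φ1 φ2 : V → V'} {hub : V'}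
    (hdis : ∀ v w : V, φ1 v ≠ φ2 w)
    (hcov : ∀ w' : V', w' = hub ∨ (∃ v, φ1 v = w') ∨ (∃ v, φ2 v = w'))
    (hna : ∀ u v : V, ¬ G'.Adj (φ1 u) (φ2 v)) {a b : V'} (p : G'.Walk a b)
    (ha : ∃ v, φ1 v = a) (hb : ∃ v, φ2 v = b) : hub ∈ p.support := by
  induction p with
  | nil =>
    obtain ⟨v, hv⟩ := ha
    obtain ⟨w, hw⟩ := hb
    exact absurd (hv.trans hw.symm) (hdis v w)
  | cons h q ih =>
    rw [Walk.support_cons, List.mem_cons]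
    right
    rcases hcov _ with h0 | h1 | ⟨w, hw⟩
    · rw [← h0]
      exact q.start_mem_support
    · exact ih h1 hb
    · obtain ⟨v, hv⟩ := ha
      subst hv hw
      exact absurd h (hna v w)

lemma doubling_step {V1 V2 V1' V2' X : Type*} [Finite X]
    (T1 : QTree V1 X) (T2 : QTree V2 X) (T1' : QTree V1' (X ⊕ X)) (T2' : QTree V2' (X ⊕ X))
    (hd1 : IsDoubling T1 T1') (hd2 : IsDoubling T2 T2') :
    2 * dMAF T1.graph T1.leaf T2.graph T2.leaf ≤
      dMAF T1'.graph T1'.leaf T2'.graph T2'.leaf + 1 := by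
  classical
  obtain ⟨B, hB⟩ : dMAF T1'.graph T1'.leaf T2'.graph T2'.leaf ∈
      {k | ∃ blocks : Fin k → Set (X ⊕ X),
        IsAgreementForest T1'.graph T1'.leaf T2'.graph T2'.leaf k blocks} :=
    Nat.sInf_mem (exists_forest T1' T2')
  obtain ⟨φ1, φ2, i1, i2, hdis, -, -, hcov, l1, l2, a1, a2, hna, -, -, -⟩ := hd1
  obtain ⟨ψ1, ψ2, j1, j2, -, -, -, -, m1, m2, b1, b2, -, -, -, -⟩ := hd2
  let SL := Finset.univ.filter (fun j => ∃ x : X, Sum.inl x ∈ B j)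
  let SR := Finset.univ.filter (fun j => ∃ x : X, Sum.inr x ∈ B j)
  have hL : _ ≤ SL.card := restrict_forest T1 T2 T1' T2' Sum.inl Sum.inl_injective
    φ1 i1 a1 l1 ψ1 j1 b1 m1 _ B hB SL (by simp [SL])
  have hR : _ ≤ SR.card := restrict_forest T1 T2 T1' T2' Sum.inr Sum.inr_injective
    φ2 i2 a2 l2 ψ2 j2 b2 m2 _ B hB SR (by simp [SR])
  have hu : (SL ∪ SR).card ≤ dMAF T1'.graph T1'.leaf T2'.graph T2'.leaf := by
    simpa using Finset.card_le_univ (SL ∪ SR)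
  have hhub : ∀ j ∈ SL ∩ SR, T1'.hub ∈ leafSpan T1'.graph T1'.leaf (B j) := by
    intro j hj
    simp only [SL, SR, Finset.mem_inter, Finset.mem_filter, Finset.mem_univ, true_and] at hj
    obtain ⟨⟨x, hx⟩, ⟨y, hy⟩⟩ := hj
    obtain ⟨p, hp⟩ := (T1'.connected.preconnected (T1'.leaf (Sum.inl x))
      (T1'.leaf (Sum.inr y))).exists_isPath
    exact ⟨_, hx, _, hy, p, hp, hub_mem_walk hdis hcov hna p ⟨_, l1 x⟩ ⟨_, l2 y⟩⟩
  have hi : (SL ∩ SR).card ≤ 1 := by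
    rw [Finset.card_le_one]
    intro a ha b hb
    by_contra hab
    have := hB.2.2.1 a b hab
    rw [Set.eq_empty_iff_forall_notMem] at this
    exact this _ ⟨hhub a ha, hhub b hb⟩
  have := Finset.card_union_add_card_inter SL SR
  omega

lemma not_leaf_of_two {V X : Type*} (T : QTree V X) {u x y : V} (hxy : x ≠ y)
    (hx : T.graph.Adj u x) (hy : T.graph.Adj u y) (z : X) : T.leaf z ≠ u := by
  rintro rfl
  obtain ⟨t, ht⟩ := Set.ncard_eq_one.1 (T.leaf_deg z)
  have h1 : x ∈ T.graph.neighborSet (T.leaf z) := hx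
  have h2 : y ∈ T.graph.neighborSet (T.leaf z) := hy
  rw [ht] at h1 h2
  exact hxy (h1.trans h2.symm)

lemma quartet_ne {V X : Type*} (T : QTree V X) {a b c d : X}
    (hab : a ≠ b) (hac : a ≠ c) (had : a ≠ d) (hbc : b ≠ c) (hbd : b ≠ d) (hcd : c ≠ d) {u : V}
    (ha : T.graph.Adj u (T.leaf a)) (hb : T.graph.Adj u (T.leaf b))
    (hc : T.graph.Adj u (T.leaf c)) (hd : T.graph.Adj u (T.leaf d))
    (hh : T.graph.Adj T.hub u) : False := by
  classical
  have := T.finite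
  have i := T.leaf_inj
  have h3 := T.internal_deg u (not_leaf_of_two T (i.ne hab) ha hb) hh.ne'
  have hsub : (({T.leaf a, T.leaf b, T.leaf c, T.leaf d} : Finset V) : Set V) ⊆
      T.graph.neighborSet u := by
    intro v hv
    simp only [Finset.coe_insert, Finset.coe_singleton, Set.mem_insert_iff,
      Set.mem_singleton_iff] at hv
    rcases hv with rfl | rfl | rfl | rfl <;> assumption
  have hle := Set.ncard_le_ncard hsub (Set.toFinite _)
  have h4 : ({T.leaf a, T.leaf b, T.leaf c, T.leaf d} : Finset V).card = 4 := by
    simp [Finset.card_insert_of_notMem, i.eq_iff, hab, hac, had, hbc, hbd, hcd]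
  rw [Set.ncard_coe_finset, h3] at hle
  omega

lemma quartet_split {V X : Type*} (T : QTree V X) {a b c d : X}
    (hab : a ≠ b) (hac : a ≠ c) (had : a ≠ d) (hbc : b ≠ c) (hbd : b ≠ d) (hcd : c ≠ d)
    (h : IsQuartet T a b c d) : QuartetSplit T.graph T.leaf a b c d := by
  obtain ⟨u, w, ha, hb, hc, hd, hu, hw⟩ := h
  have i := T.leaf_inj
  have huw : u ≠ w := by
    rintro rfl
    exact quartet_ne T hab hac had hbc hbd hcd ha hb hc hd hu
  have nu := not_leaf_of_two T (i.ne hab) ha hb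
  have nw := not_leaf_of_two T (i.ne hcd) hc hd
  have p1 := pathSupport_eq_of_isPath T.acyclic (Walk.cons ha.symm (Walk.cons hb Walk.nil))
    (by simp [Walk.isPath_def, i.eq_iff, hab, nu a, (nu b).symm])
  have p2 := pathSupport_eq_of_isPath T.acyclic (Walk.cons hc.symm (Walk.cons hd Walk.nil))
    (by simp [Walk.isPath_def, i.eq_iff, hcd, nw c, (nw d).symm])
  unfold QuartetSplit
  rw [p1, p2, Set.eq_empty_iff_forall_notMem]
  rintro v ⟨h, h'⟩
  simp only [Walk.support_cons, Walk.support_nil, Set.mem_setOf_eq, List.mem_cons,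
    List.not_mem_nil, or_false] at h h'
  rcases h with rfl | rfl | rfl <;> rcases h' with h' | h' | h' <;>
    first
    | exact absurd (i h') (by assumption)
    | exact absurd h' (by assumption)
    | exact absurd h' (nw _)
    | exact absurd h'.symm (nu _)

lemma hub_mem_path {V X : Type*} (T : QTree V X) {a b : X} (hab : a ≠ b) {u w : V}
    (ha : T.graph.Adj u (T.leaf a)) (hu : T.graph.Adj T.hub u)
    (hw : T.graph.Adj T.hub w) (hb : T.graph.Adj w (T.leaf b)) (huw : u ≠ w)
    (nu : ∀ x, T.leaf x ≠ u) (nw : ∀ x, T.leaf x ≠ w) :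
    T.hub ∈ pathSupport T.graph (T.leaf a) (T.leaf b) := by
  refine ⟨Walk.cons ha.symm (Walk.cons hu.symm (Walk.cons hw (Walk.cons hb Walk.nil))), ?_, ?_⟩
  · simp [Walk.isPath_def, T.leaf_inj.eq_iff, hab, nu a, (nu b).symm, nw a, (nw b).symm, huw,
      hu.ne', hw.ne, T.hub_not_leaf a, (T.hub_not_leaf b).symm]
  · simp

lemma quartet_not_split {V X : Type*} (T : QTree V X) {a b c d : X}
    (hab : a ≠ b) (hac : a ≠ c) (had : a ≠ d) (hbc : b ≠ c) (hbd : b ≠ d) (hcd : c ≠ d)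
    (h : IsQuartet T a c b d) : ¬ QuartetSplit T.graph T.leaf a b c d := by
  obtain ⟨u, w, ha, hc, hb, hd, hu, hw⟩ := h
  have i := T.leaf_inj
  have huw : u ≠ w := by
    rintro rfl
    exact quartet_ne T hab hac had hbc hbd hcd ha hb hc hd hu
  have nu := not_leaf_of_two T (i.ne hac) ha hc
  have nw := not_leaf_of_two T (i.ne hbd) hb hd
  intro hs
  unfold QuartetSplit at hs
  rw [Set.eq_empty_iff_forall_notMem] at hs
  exact hs T.hub ⟨hub_mem_path T hab ha hu hw hb huw nu nw,
    hub_mem_path T hcd hc hu hw hd huw nu nw⟩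

lemma quartet_base {V1 V2 : Type*} (T1 : QTree V1 (Fin 4)) (T2 : QTree V2 (Fin 4))
    (h1 : IsQuartet T1 0 1 2 3) (h2 : IsQuartet T2 0 2 1 3) :
    2 ≤ dMAF T1.graph T1.leaf T2.graph T2.leaf := by
  obtain ⟨B, hne, hex, -, -, hr⟩ : dMAF T1.graph T1.leaf T2.graph T2.leaf ∈
      {k | ∃ blocks : Fin k → Set (Fin 4),
        IsAgreementForest T1.graph T1.leaf T2.graph T2.leaf k blocks} :=
    Nat.sInf_mem (exists_forest T1 T2)
  by_contra hlt
  have hs : ∀ i j : Fin (dMAF T1.graph T1.leaf T2.graph T2.leaf), i = j := by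
    intro i j
    apply Fin.ext
    omega
  obtain ⟨j, -, -⟩ := hex 0
  have hm : ∀ x, x ∈ B j := by
    intro x
    obtain ⟨i, hi, -⟩ := hex x
    rwa [hs j i]
  have := hr j 0 (hm 0) 1 (hm 1) 2 (hm 2) 3 (hm 3) (by decide) (by decide) (by decide)
    (by decide) (by decide) (by decide)
  exact quartet_not_split T2 (by decide) (by decide) (by decide)
    (by decide) (by decide) (by decide) h2 (this.1 (quartet_split T1 (by decide) (by decide)
      (by decide) (by decide) (by decide) (by decide) h1))

lemma lab_finite : ∀ i, Finite (lab i)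
  | 0 => inferInstanceAs (Finite (Fin 4))
  | i + 1 => by
    have := lab_finite i
    exact inferInstanceAs (Finite (lab i ⊕ lab i))

/-- In the doubled quartet construction, the maximum-agreement-forest distance
grows at each doubling step:
`d_MAF(T¹ᵢ₊₁, T²ᵢ₊₁) ≥ 2·d_MAF(T¹ᵢ, T²ᵢ) - 1 > d_MAF(T¹ᵢ, T²ᵢ)`. -/
theorem doubled_quartet_dMAF_grows (V1 V2 : ℕ → Type)
    (T1 : ∀ i, QTree (V1 i) (lab i)) (T2 : ∀ i, QTree (V2 i) (lab i))
    (h1 : IsQuartet (T1 0) (0 : Fin 4) (1 : Fin 4) (2 : Fin 4) (3 : Fin 4))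
    (h2 : IsQuartet (T2 0) (0 : Fin 4) (2 : Fin 4) (1 : Fin 4) (3 : Fin 4))
    (hd1 : ∀ i, IsDoubling (T1 i) (T1 (i + 1)))
    (hd2 : ∀ i, IsDoubling (T2 i) (T2 (i + 1))) (i : ℕ) :
    2 * dMAF (T1 i).graph (T1 i).leaf (T2 i).graph (T2 i).leaf - 1 ≤
      dMAF (T1 (i + 1)).graph (T1 (i + 1)).leaf (T2 (i + 1)).graph (T2 (i + 1)).leaf ∧
    dMAF (T1 i).graph (T1 i).leaf (T2 i).graph (T2 i).leaf <
      2 * dMAF (T1 i).graph (T1 i).leaf (T2 i).graph (T2 i).leaf - 1 := by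
  have step : ∀ i, 2 * dMAF (T1 i).graph (T1 i).leaf (T2 i).graph (T2 i).leaf ≤
      dMAF (T1 (i + 1)).graph (T1 (i + 1)).leaf (T2 (i + 1)).graph (T2 (i + 1)).leaf + 1 := by
    intro i
    have := lab_finite i
    exact doubling_step (T1 i) (T2 i) (T1 (i + 1)) (T2 (i + 1)) (hd1 i) (hd2 i)
  have two : ∀ i, 2 ≤ dMAF (T1 i).graph (T1 i).leaf (T2 i).graph (T2 i).leaf := by
    intro i
    induction i with
    | zero => exact quartet_base (T1 0) (T2 0) h1 h2
    | succ i ih =>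
      have := step i
      omega
  have h3 := step i
  have h4 := two i
  constructor <;> omega
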